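/- Let K be an origin-symmetric convex body in ℝⁿ and let μ be the measure on ℝⁿ with density e^{−V}, where V : ℝⁿ → ℝ is an even convex C² function. Then ∫_K |∇V(x)|² dμ(x) ≤ ∫_K ΔV(x) dμ(x). -/

import Mathlib

open MeasureTheory
open scoped RealInnerProductSpace ENNReal

noncomputable section

abbrev Euc (n : ℕ) : Type := EuclideanSpace ℝ (Fin n)

/-- A convex body: a compact convex set with nonempty interior. -/
def IsConvexBody {n : ℕ} (K : Set (Euc n)) : Prop :=
  IsCompact K ∧ Convex ℝ K ∧ (interior K).Nonempty

/-- The support function `h_K(u) = sup_{y ∈ K} ⟨u, y⟩`. -/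
def suppFn {n : ℕ} (K : Set (Euc n)) (u : Euc n) : ℝ :=
  sSup ((fun y => ⟪u, y⟫) '' K)

/-- `lpComb p lam K L` is the `L_p` combination `lam·K +_p (1−lam)·L`;
for `p = 0` it is the logarithmic combination. -/
def lpComb {n : ℕ} (p lam : ℝ) (K L : Set (Euc n)) : Set (Euc n) :=
  if p = 0 then
    {x | ∀ u : Euc n, ‖u‖ = 1 → ⟪x, u⟫ ≤ suppFn K u ^ lam * suppFn L u ^ (1 - lam)}
  else
    {x | ∀ u : Euc n, ‖u‖ = 1 →
      ⟪x, u⟫ ≤ (lam * suppFn K u ^ p + (1 - lam) * suppFn L u ^ p) ^ (1 / p)}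


/-- The Laplacian `Δ V` of a function on `ℝⁿ`, as the trace of its Hessian. -/
def lapl {n : ℕ} (V : Euc n → ℝ) (x : Euc n) : ℝ :=
  ∑ i : Fin n,
    iteratedFDeriv ℝ 2 V x ![EuclideanSpace.single i 1, EuclideanSpace.single i 1]

/-- One-dimensional Brunn–Minkowski inequality for nonempty compact sets. -/
theorem volume_add_le_of_midpoint_mem_of_isCompact {A B C : Set ℝ} (hA : IsCompact A)
    (hB : IsCompact B) (hAn : A.Nonempty) (hBn : B.Nonempty)
    (h : ∀ a ∈ A, ∀ b ∈ B, (2 : ℝ)⁻¹ * (a + b) ∈ C) :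
    volume A + volume B ≤ 2 * volume C := by
  obtain ⟨a, haA, ha⟩ := hA.exists_isGreatest hAn
  obtain ⟨b, hbB, hb⟩ := hB.exists_isLeast hBn
  have hY : MeasurableSet ((fun z => z + -a) ⁻¹' B) :=
    (measurable_add_const (-a)) hB.measurableSet
  calc volume A + volume B
      = volume ((fun z => z + -b) ⁻¹' A) + volume ((fun z => z + -a) ⁻¹' B) := by
        rw [measure_preimage_add_right, measure_preimage_add_right]
    _ = volume ((fun z => z + -b) ⁻¹' A ∪ (fun z => z + -a) ⁻¹' B) := by
        refine (measure_union₀ hY.nullMeasurableSet ?_).symm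
        refine measure_mono_null (t := {a + b}) ?_ (measure_singleton _)
        rintro z ⟨hz₁, hz₂⟩
        have h₁ := ha hz₁
        have h₂ := hb hz₂
        simp only [Set.mem_singleton_iff]
        linarith
    _ ≤ volume ((fun z => (2 : ℝ)⁻¹ * z) ⁻¹' C) := by
        refine measure_mono ?_
        rintro z (hz | hz)
        · simpa using h _ hz _ hbB
        · simpa using h _ haA _ hz
    _ = 2 * volume C := by
        rw [Real.volume_preimage_mul_left (by norm_num)]
        norm_num

/-- One-dimensional Brunn–Minkowski inequality for nonempty measurable sets. -/
theorem volume_add_le_of_midpoint_mem {A B C : Set ℝ} (hA : MeasurableSet A)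
    (hB : MeasurableSet B) (hAn : A.Nonempty) (hBn : B.Nonempty)
    (h : ∀ a ∈ A, ∀ b ∈ B, (2 : ℝ)⁻¹ * (a + b) ∈ C) :
    volume A + volume B ≤ 2 * volume C := by
  obtain ⟨a, ha⟩ := hAn
  obtain ⟨b, hb⟩ := hBn
  rw [hA.measure_eq_iSup_isCompact, hB.measure_eq_iSup_isCompact]
  simp only [iSup_and']
  refine ENNReal.biSup_add_biSup_le' ⟨∅, by simp⟩ ⟨∅, by simp⟩ ?_
  rintro A' ⟨hA', hA'c⟩ B' ⟨hB', hB'c⟩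
  refine le_trans (add_le_add (measure_mono (Set.subset_insert a A'))
    (measure_mono (Set.subset_insert b B'))) ?_
  exact volume_add_le_of_midpoint_mem_of_isCompact (hA'c.insert a) (hB'c.insert b)
    (Set.insert_nonempty _ _) (Set.insert_nonempty _ _) fun x hx y hy =>
    h x (Set.insert_subset ha hA' hx) y (Set.insert_subset hb hB' hy)

/-- The Prékopa–Leindler inequality on the line for functions with supremum one, in additive
form. -/
theorem lintegral_add_le_of_mul_le_sq_midpoint {f g h : ℝ → ℝ} (hf : Measurable f)
    (hg : Measurable g) (hh : Measurable h) (hf0 : 0 ≤ f) (hg0 : 0 ≤ g) (hh0 : 0 ≤ h)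
    (hf1 : ∀ x, f x ≤ 1) (hg1 : ∀ x, g x ≤ 1) (hfs : ∀ s < 1, ∃ x, s < f x)
    (hgs : ∀ s < 1, ∃ x, s < g x) (hfgh : ∀ x y, f x * g y ≤ h ((2 : ℝ)⁻¹ * (x + y)) ^ 2) :
    (∫⁻ x, ENNReal.ofReal (f x)) + ∫⁻ x, ENNReal.ofReal (g x)
      ≤ 2 * ∫⁻ x, ENNReal.ofReal (h x) := by
  have hanti : ∀ k : ℝ → ℝ, Measurable fun t : ℝ => volume {x | t < k x} := fun k =>
    Antitone.measurable fun s t hst => measure_mono fun x (hx : t < k x) => hst.trans_lt hx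
  rw [lintegral_eq_lintegral_meas_lt _ (Filter.Eventually.of_forall hf0) hf.aemeasurable,
    lintegral_eq_lintegral_meas_lt _ (Filter.Eventually.of_forall hg0) hg.aemeasurable,
    lintegral_eq_lintegral_meas_lt _ (Filter.Eventually.of_forall hh0) hh.aemeasurable,
    ← lintegral_add_left (hanti f), ← lintegral_const_mul _ (hanti h)]
  refine setLIntegral_mono' measurableSet_Ioi fun t (ht : 0 < t) => ?_
  rcases lt_or_ge t 1 with ht1 | ht1
  · refine volume_add_le_of_midpoint_mem (measurableSet_lt measurable_const hf)
      (measurableSet_lt measurable_const hg) (hfs t ht1) (hgs t ht1) fun x hx y hy => ?_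
    change t < f x at hx
    change t < g y at hy
    refine lt_of_pow_lt_pow_left₀ 2 (hh0 _) ((hfgh x y).trans_lt' ?_)
    nlinarith
  · have hempty : ∀ k : ℝ → ℝ, (∀ x, k x ≤ 1) → {x | t < k x} = ∅ := fun k hk =>
      Set.eq_empty_of_forall_notMem fun x (hx : t < k x) => (hk x).not_gt (ht1.trans_lt hx)
    simp [hempty f hf1, hempty g hg1]

/-- The Prékopa–Leindler inequality for midpoints, as a property of a measure. -/
def MidpointPrekopaLeindler {E : Type*} [AddCommGroup E] [Module ℝ E] [MeasurableSpace E]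
    (μ : Measure E) : Prop :=
  ∀ f g h : E → ℝ≥0∞, Measurable f → Measurable g → Measurable h →
    (∀ x y, f x * g y ≤ h ((2 : ℝ)⁻¹ • (x + y)) ^ 2) →
    (∫⁻ x, f x ∂μ) * (∫⁻ x, g x ∂μ) ≤ (∫⁻ x, h x ∂μ) ^ 2

theorem ENNReal.mul_le_sq_of_add_le_two_mul {p q r : ℝ≥0∞} (h : p + q ≤ 2 * r) :
    p * q ≤ r ^ 2 := by
  rcases eq_or_ne r ⊤ with rfl | hr
  · simp
  have hpq : p + q ≠ ⊤ := ne_top_of_le_ne_top (by finiteness) h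
  obtain ⟨hp, hq⟩ := ENNReal.add_ne_top.1 hpq
  lift p to NNReal using hp
  lift q to NNReal using hq
  lift r to NNReal using hr
  norm_cast at h ⊢
  have h' : (p : ℝ) + q ≤ 2 * r := by exact_mod_cast h
  have : (p : ℝ) * q ≤ r ^ 2 := by
    nlinarith [sq_nonneg ((p : ℝ) - q), p.2, q.2, r.2, NNReal.coe_nonneg p, NNReal.coe_nonneg q]
  exact_mod_cast this

theorem ENNReal.exists_sq_eq {a : ℝ≥0∞} : ∃ c, c ^ 2 = a :=
  ⟨a ^ (2⁻¹ : ℝ), by rw [← ENNReal.rpow_natCast, ← ENNReal.rpow_mul]; norm_num⟩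

theorem lintegral_mul_lintegral_le_sq_of_iSup_ne_top {f g h : ℝ → ℝ≥0∞} (hf : Measurable f)
    (hg : Measurable g) (hh : Measurable h) (hfb : ⨆ x, f x ≠ ⊤) (hgb : ⨆ x, g x ≠ ⊤)
    (hfgh : ∀ x y, f x * g y ≤ h ((2 : ℝ)⁻¹ * (x + y)) ^ 2) :
    (∫⁻ x, f x) * (∫⁻ x, g x) ≤ (∫⁻ x, h x) ^ 2 := by
  set a := ⨆ x, f x with ha
  set b := ⨆ x, g x with hb
  have hfa : ∀ x, f x ≤ a := le_iSup f
  have hgb' : ∀ x, g x ≤ b := le_iSup g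
  rcases eq_or_ne a 0 with ha0 | ha0
  · have : ∀ x, f x = 0 := fun x => le_antisymm (ha0 ▸ hfa x) zero_le
    simp [this]
  rcases eq_or_ne b 0 with hb0 | hb0
  · have : ∀ x, g x = 0 := fun x => le_antisymm (hb0 ▸ hgb' x) zero_le
    simp [this]
  obtain ⟨c, hc⟩ : ∃ c, c ^ 2 = a * b := ENNReal.exists_sq_eq
  have hc0 : c ≠ 0 := by
    rintro rfl
    exact mul_ne_zero ha0 hb0 (by simp [← hc])
  have hct : c ≠ ⊤ := by
    rintro rfl
    exact ENNReal.mul_ne_top hfb hgb (by simp [← hc])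
  have hf1 : ∀ x, f x / a ≤ 1 := fun x => ENNReal.div_le_of_le_mul (by simpa using hfa x)
  have hg1 : ∀ x, g x / b ≤ 1 := fun x => ENNReal.div_le_of_le_mul (by simpa using hgb' x)
  have hft : ∀ x, f x / a ≠ ⊤ := fun x => ne_top_of_le_ne_top ENNReal.one_ne_top (hf1 x)
  have hgt : ∀ x, g x / b ≠ ⊤ := fun x => ne_top_of_le_ne_top ENNReal.one_ne_top (hg1 x)
  have hht : ∀ x, min (h x / c) 1 ≠ ⊤ := fun x =>
    ne_top_of_le_ne_top ENNReal.one_ne_top (min_le_right _ _)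
  have hsup : ∀ (k : ℝ → ℝ≥0∞) (m : ℝ≥0∞), m ≠ 0 → m ≠ ⊤ → m = ⨆ x, k x →
      (∀ x, k x / m ≠ ⊤) → ∀ s < (1 : ℝ), ∃ x, s < (k x / m).toReal := by
    intro k m hm0 hmt hm hkt s hs
    have hlt : ENNReal.ofReal s * m < ⨆ x, k x := by
      rw [← hm]
      calc ENNReal.ofReal s * m < 1 * m :=
            (ENNReal.mul_lt_mul_iff_left hm0 hmt).2 (by simpa using hs)
        _ = m := one_mul m
    obtain ⟨x, hx⟩ := lt_iSup_iff.1 hlt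
    refine ⟨x, ?_⟩
    have hx' : ENNReal.ofReal s < k x / m :=
      (ENNReal.lt_div_iff_mul_lt (Or.inl hm0) (Or.inl hmt)).2 hx
    calc s ≤ (ENNReal.ofReal s).toReal := by
          rw [ENNReal.toReal_ofReal']
          exact le_max_left _ _
      _ < (k x / m).toReal := ENNReal.toReal_strict_mono (hkt x) hx'
  have key := lintegral_add_le_of_mul_le_sq_midpoint
    (f := fun x => (f x / a).toReal) (g := fun x => (g x / b).toReal)
    (h := fun x => (min (h x / c) 1).toReal)
    (hf.div_const a).ennreal_toReal (hg.div_const b).ennreal_toReal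
    ((hh.div_const c).min measurable_const).ennreal_toReal
    (fun _ => ENNReal.toReal_nonneg) (fun _ => ENNReal.toReal_nonneg)
    (fun _ => ENNReal.toReal_nonneg)
    (fun x => ENNReal.toReal_mono ENNReal.one_ne_top (hf1 x))
    (fun x => ENNReal.toReal_mono ENNReal.one_ne_top (hg1 x))
    (hsup f a ha0 hfb ha hft) (hsup g b hb0 hgb hb hgt) (fun x y => by
      rw [← ENNReal.toReal_mul, ← ENNReal.toReal_pow]
      refine ENNReal.toReal_mono (ENNReal.pow_ne_top (hht _)) ?_
      rcases min_choice (h ((2 : ℝ)⁻¹ * (x + y)) / c) 1 with hm | hm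
      · rw [hm, div_eq_mul_inv, div_eq_mul_inv, div_eq_mul_inv, mul_pow, ← ENNReal.inv_pow, hc,
          ENNReal.mul_inv (Or.inl ha0) (Or.inl hfb), mul_mul_mul_comm]
        gcongr
        exact hfgh x y
      · rw [hm, one_pow]
        exact mul_le_one' (hf1 x) (hg1 y))
  simp only [ENNReal.ofReal_toReal (hft _), ENNReal.ofReal_toReal (hgt _),
    ENNReal.ofReal_toReal (hht _)] at key
  have key' : (∫⁻ x, f x) / a + (∫⁻ x, g x) / b ≤ 2 * ((∫⁻ x, h x) / c) := by
    have hdiv : ∀ k : ℝ → ℝ≥0∞, Measurable k → ∀ m, ∫⁻ x, k x / m = (∫⁻ x, k x) / m :=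
      fun k hk m => by simp only [div_eq_mul_inv, lintegral_mul_const _ hk]
    rw [← hdiv f hf, ← hdiv g hg, ← hdiv h hh]
    exact key.trans (mul_le_mul_right (lintegral_mono fun x => min_le_left _ _) 2)
  have hprod := ENNReal.mul_le_sq_of_add_le_two_mul key'
  calc (∫⁻ x, f x) * (∫⁻ x, g x)
      = ((∫⁻ x, f x) / a * ((∫⁻ x, g x) / b)) * (a * b) := by
        rw [mul_mul_mul_comm, ENNReal.div_mul_cancel ha0 hfb, ENNReal.div_mul_cancel hb0 hgb]
    _ ≤ ((∫⁻ x, h x) / c) ^ 2 * c ^ 2 := by rw [hc]; gcongr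
    _ = (∫⁻ x, h x) ^ 2 := by rw [← mul_pow, ENNReal.div_mul_cancel hc0 hct]

theorem lintegral_eq_iSup_lintegral_min_natCast {α : Type*} [MeasurableSpace α] {μ : Measure α}
    {f : α → ℝ≥0∞} (hf : Measurable f) :
    ∫⁻ x, f x ∂μ = ⨆ n : ℕ, ∫⁻ x, min (f x) n ∂μ := by
  rw [← lintegral_iSup (fun n => hf.min measurable_const)
    fun m n hmn x => min_le_min_left _ (by exact_mod_cast hmn)]
  congr with x
  rw [← inf_iSup_eq, ENNReal.iSup_natCast, inf_top_eq]

theorem midpointPrekopaLeindler_real : MidpointPrekopaLeindler (volume : Measure ℝ) := by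
  intro f g h hf hg hh hfgh
  rw [lintegral_eq_iSup_lintegral_min_natCast hf, lintegral_eq_iSup_lintegral_min_natCast hg,
    ENNReal.iSup_mul]
  refine iSup_le fun m => ?_
  rw [ENNReal.mul_iSup]
  refine iSup_le fun n => ?_
  refine lintegral_mul_lintegral_le_sq_of_iSup_ne_top (hf.min measurable_const)
    (hg.min measurable_const) hh
    (ne_top_of_le_ne_top (ENNReal.natCast_ne_top m) (iSup_le fun _ => min_le_right _ _))
    (ne_top_of_le_ne_top (ENNReal.natCast_ne_top n) (iSup_le fun _ => min_le_right _ _))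
    fun x y => ?_
  exact (mul_le_mul' (min_le_left _ _) (min_le_left _ _)).trans (hfgh x y)

namespace MidpointPrekopaLeindler

variable {E F : Type*} [AddCommGroup E] [Module ℝ E] [MeasurableSpace E]
  [AddCommGroup F] [Module ℝ F] [MeasurableSpace F] {μ : Measure E} {ν : Measure F}

theorem prod [SFinite ν] (hμ : MidpointPrekopaLeindler μ) (hν : MidpointPrekopaLeindler ν) :
    MidpointPrekopaLeindler (μ.prod ν) := by
  intro f g h hf hg hh hfgh
  rw [lintegral_prod _ hf.aemeasurable, lintegral_prod _ hg.aemeasurable,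
    lintegral_prod _ hh.aemeasurable]
  refine hμ _ _ _ hf.lintegral_prod_right' hg.lintegral_prod_right' hh.lintegral_prod_right'
    fun x x' => ?_
  exact hν _ _ _ (hf.comp measurable_prodMk_left) (hg.comp measurable_prodMk_left)
    (hh.comp measurable_prodMk_left) fun y y' => hfgh (x, y) (x', y')

theorem of_measurePreserving {φ : E → F} (hμ : MidpointPrekopaLeindler μ)
    (hφ : MeasurePreserving φ μ ν)
    (hmid : ∀ x y, φ ((2 : ℝ)⁻¹ • (x + y)) = (2 : ℝ)⁻¹ • (φ x + φ y)) :
    MidpointPrekopaLeindler ν := by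
  intro f g h hf hg hh hfgh
  rw [← hφ.lintegral_comp hf, ← hφ.lintegral_comp hg, ← hφ.lintegral_comp hh]
  exact hμ _ _ _ (hf.comp hφ.measurable) (hg.comp hφ.measurable) (hh.comp hφ.measurable)
    fun x y => by simpa only [Function.comp_apply, hmid] using hfgh (φ x) (φ y)

end MidpointPrekopaLeindler

theorem midpointPrekopaLeindler_pi (n : ℕ) :
    MidpointPrekopaLeindler (volume : Measure (Fin n → ℝ)) := by
  induction n with
  | zero =>
    intro f g h hf hg hh hfgh
    rw [Measure.volume_pi_eq_dirac 0, lintegral_dirac' _ hf, lintegral_dirac' _ hg,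
      lintegral_dirac' _ hh]
    simpa using hfgh 0 0
  | succ n ih =>
    refine (midpointPrekopaLeindler_real.prod ih).of_measurePreserving
      ((volume_preserving_piFinSuccAbove (fun _ : Fin (n + 1) => ℝ) 0).symm _) fun x y => ?_
    ext i
    refine Fin.cases ?_ (fun j => ?_) i <;> simp [MeasurableEquiv.piFinSuccAbove, mul_add]

theorem midpointPrekopaLeindler_euclideanSpace (n : ℕ) :
    MidpointPrekopaLeindler (volume : Measure (EuclideanSpace ℝ (Fin n))) :=
  (midpointPrekopaLeindler_pi n).of_measurePreserving (PiLp.volume_preserving_toLp (Fin n))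
    fun _ _ => rfl

/-- Differentiation under the integral sign along a line, over a compact set. -/
theorem hasDerivAt_setIntegral_comp_add_smul {E : Type*} [NormedAddCommGroup E]
    [NormedSpace ℝ E] [MeasurableSpace E] [BorelSpace E] {μ : Measure E}
    [IsFiniteMeasureOnCompacts μ] {K : Set E} (hK : IsCompact K) {φ : E → ℝ}
    (hφ : ContDiff ℝ 1 φ) (e : E) (t₀ : ℝ) :
    HasDerivAt (fun t : ℝ => ∫ x in K, φ (x + t • e) ∂μ)
      (∫ x in K, fderiv ℝ φ (x + t₀ • e) e ∂μ) t₀ := by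
  have hφ' : Continuous fun p : E × ℝ => fderiv ℝ φ (p.1 + p.2 • e) e :=
    ((hφ.continuous_fderiv one_ne_zero).comp (by fun_prop)).clm_apply continuous_const
  obtain ⟨C, hC⟩ := (hK.prod (isCompact_closedBall t₀ 1)).exists_bound_of_continuousOn
    hφ'.continuousOn
  have hmeas : ∀ k : E → ℝ, Continuous k → IntegrableOn k K μ := fun k hk =>
    hk.continuousOn.integrableOn_compact hK
  refine (hasDerivAt_integral_of_dominated_loc_of_deriv_le (bound := fun _ => C)
    (F' := fun t x => fderiv ℝ φ (x + t • e) e)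
    (Metric.closedBall_mem_nhds t₀ one_pos) (Filter.Eventually.of_forall fun t =>
      (hmeas _ (hφ.continuous.comp (by fun_prop))).aestronglyMeasurable)
    (hmeas _ (hφ.continuous.comp (by fun_prop)))
    (hmeas _ (hφ'.comp (by fun_prop : Continuous fun x : E => (x, t₀)))).aestronglyMeasurable
    ?_ (hmeas _ continuous_const) ?_).2
  · filter_upwards [ae_restrict_mem hK.measurableSet] with x hx t ht
    exact hC (x, t) ⟨hx, ht⟩
  · refine Filter.Eventually.of_forall fun x t _ => ?_
    have hline : HasDerivAt (fun t : ℝ => x + t • e) e t := by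
      simpa using ((hasDerivAt_id t).smul_const e).const_add x
    exact ((hφ.differentiable one_ne_zero) (x + t • e)).hasFDerivAt.comp_hasDerivAt t hline

theorem deriv_deriv_nonpos_of_isLocalMax {f : ℝ → ℝ} {x : ℝ} (hf : IsLocalMax f x)
    (hc : ContinuousAt f x) : deriv (deriv f) x ≤ 0 := by
  by_contra! hpos
  have hmin := isLocalMin_of_deriv_deriv_pos hpos hf.deriv_eq_zero hc
  have hconst : f =ᶠ[nhds x] fun _ => f x := by
    filter_upwards [hf, hmin] with y h₁ h₂ using le_antisymm h₁ h₂
  have := hconst.deriv.deriv_eq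
  simp_all

section
variable {n : ℕ} {K : Set (Euc n)} {V : Euc n → ℝ}

/-- Anderson's inequality for an even log-concave density. -/
theorem setIntegral_exp_neg_add_le (hK : IsCompact K) (hKconv : Convex ℝ K) (hKsym : K = -K)
    (hV : Continuous V) (hVconv : ConvexOn ℝ Set.univ V) (hVeven : ∀ x, V (-x) = V x)
    (v : Euc n) :
    ∫ x in K, Real.exp (-V (x + v)) ≤ ∫ x in K, Real.exp (-V x) := by
  set F : Euc n → Euc n → ℝ≥0∞ :=
    fun v => K.indicator fun x => ENNReal.ofReal (Real.exp (-V (x + v))) with hF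
  have hcont : ∀ v, Continuous fun x : Euc n => Real.exp (-V (x + v)) := fun v => by fun_prop
  have hFm : ∀ v, Measurable (F v) := fun v =>
    ((hcont v).measurable.ennreal_ofReal).indicator hK.measurableSet
  have hmem : ∀ x, -x ∈ K ↔ x ∈ K := fun x => by rw [← Set.mem_neg, ← hKsym]
  have hneg : ∫⁻ x, F (-v) x = ∫⁻ x, F v x := by
    rw [← lintegral_neg_eq_self]
    refine lintegral_congr fun x => ?_
    by_cases hx : x ∈ K
    · simp only [hF, Set.indicator_of_mem hx, Set.indicator_of_mem ((hmem x).2 hx)]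
      rw [← neg_add, hVeven]
    · simp only [hF, Set.indicator_of_notMem hx, Set.indicator_of_notMem (mt (hmem x).1 hx)]
  have hPL := midpointPrekopaLeindler_euclideanSpace n (F v) (F (-v)) (F 0) (hFm _) (hFm _)
    (hFm _) fun x y => by
      by_cases hx : x ∈ K
      swap
      · simp [hF, hx]
      by_cases hy : y ∈ K
      swap
      · simp [hF, hy]
      have hxy : (2 : ℝ)⁻¹ • (x + y) ∈ K := by
        rw [smul_add]
        exact hKconv hx hy (by norm_num) (by norm_num) (by norm_num)
      simp only [hF, Set.indicator_of_mem hx, Set.indicator_of_mem hy, Set.indicator_of_mem hxy]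
      rw [← ENNReal.ofReal_mul (Real.exp_nonneg _), ← ENNReal.ofReal_pow (Real.exp_nonneg _),
        ← Real.exp_add, ← Real.exp_nat_mul]
      refine ENNReal.ofReal_le_ofReal (Real.exp_le_exp.2 ?_)
      have hconv := hVconv.2 (Set.mem_univ (x + v)) (Set.mem_univ (y + -v))
        (by norm_num : (0 : ℝ) ≤ 2⁻¹) (by norm_num : (0 : ℝ) ≤ 2⁻¹) (by norm_num)
      rw [← smul_add, add_add_add_comm, add_neg_cancel] at hconv
      simp only [smul_eq_mul, add_zero] at hconv
      push_cast
      rw [add_zero]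
      linarith
  rw [hneg, ← sq] at hPL
  have hle : ∫⁻ x, F v x ≤ ∫⁻ x, F 0 x := (ENNReal.pow_le_pow_left_iff two_ne_zero).1 hPL
  have hint : ∀ v, ∫ x in K, Real.exp (-V (x + v)) = (∫⁻ x, F v x).toReal := fun v => by
    rw [lintegral_indicator hK.measurableSet]
    exact integral_eq_lintegral_of_nonneg_ae
      (Filter.Eventually.of_forall fun _ => Real.exp_nonneg _) (hcont v).aestronglyMeasurable
  have h0 := hint 0
  simp only [add_zero] at h0
  rw [hint v, h0]
  refine ENNReal.toReal_mono ?_ hle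
  rw [lintegral_indicator hK.measurableSet]
  exact (((hcont 0).continuousOn.integrableOn_compact hK).lintegral_lt_top).ne

theorem hasFDerivAt_exp_neg (hV : Differentiable ℝ V) (x : Euc n) :
    HasFDerivAt (fun y => Real.exp (-V y)) (Real.exp (-V x) • -fderiv ℝ V x) x :=
  (hV x).hasFDerivAt.neg.exp

/-- The second directional derivative of `e^{-V}`. -/
theorem fderiv_fderiv_exp_neg (hV : ContDiff ℝ 2 V) (x e : Euc n) :
    fderiv ℝ (fun y => fderiv ℝ (fun z => Real.exp (-V z)) y e) x e =
      Real.exp (-V x) * (fderiv ℝ V x e ^ 2 - iteratedFDeriv ℝ 2 V x ![e, e]) := by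
  have hVd : Differentiable ℝ V := hV.differentiable two_ne_zero
  have hfirst : (fun y => fderiv ℝ (fun z => Real.exp (-V z)) y e) =
      fun y => Real.exp (-V y) * -(fderiv ℝ V y e) := by
    ext y
    rw [(hasFDerivAt_exp_neg hVd y).fderiv]
    simp
  have hV' : HasFDerivAt (fun y => fderiv ℝ V y e)
      ((fderiv ℝ (fderiv ℝ V) x).flip e) x := by
    have hd : DifferentiableAt ℝ (fderiv ℝ V) x :=
      (hV.fderiv_right (m := 1) (by norm_num)).differentiable one_ne_zero x
    simpa using hd.hasFDerivAt.clm_apply (hasFDerivAt_const e x)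
  have hsecond : HasFDerivAt (fun y => Real.exp (-V y) * -(fderiv ℝ V y e)) _ x :=
    (hasFDerivAt_exp_neg hVd x).mul hV'.neg
  rw [hfirst, hsecond.fderiv, iteratedFDeriv_two_apply]
  simp
  ring

theorem setIntegral_exp_neg_mul_nonpos (hK : IsCompact K) (hKconv : Convex ℝ K)
    (hKsym : K = -K) (hV : ContDiff ℝ 2 V) (hVconv : ConvexOn ℝ Set.univ V)
    (hVeven : ∀ x, V (-x) = V x) (e : Euc n) :
    ∫ x in K, Real.exp (-V x) * (fderiv ℝ V x e ^ 2 - iteratedFDeriv ℝ 2 V x ![e, e]) ≤ 0 := by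
  have hφ : ContDiff ℝ 2 fun x => Real.exp (-V x) := hV.neg.exp
  have hψ : ContDiff ℝ 1 fun y => fderiv ℝ (fun z => Real.exp (-V z)) y e :=
    (hφ.fderiv_right (m := 1) (by norm_num)).clm_apply contDiff_const
  have h₁ := hasDerivAt_setIntegral_comp_add_smul (μ := volume) hK
    (hφ.of_le one_le_two) e
  have h₂ := hasDerivAt_setIntegral_comp_add_smul (μ := volume) hK hψ e 0
  have hmax : IsLocalMax (fun t : ℝ => ∫ x in K, Real.exp (-V (x + t • e))) 0 :=
    Filter.Eventually.of_forall fun t => by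
      simpa using setIntegral_exp_neg_add_le hK hKconv hKsym hV.continuous hVconv hVeven (t • e)
  have key := deriv_deriv_nonpos_of_isLocalMax hmax (h₁ 0).continuousAt
  rw [funext fun t => (h₁ t).deriv, h₂.deriv] at key
  simpa only [zero_smul, add_zero, fderiv_fderiv_exp_neg hV] using key

theorem norm_gradient_sq_eq_sum (x : Euc n) :
    ‖gradient V x‖ ^ 2 = ∑ i : Fin n, fderiv ℝ V x (EuclideanSpace.single i 1) ^ 2 := by
  rw [EuclideanSpace.norm_sq_eq]
  refine Finset.sum_congr rfl fun i _ => ?_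
  rw [← toDual_gradient, InnerProductSpace.toDual_apply_apply,
    EuclideanSpace.inner_single_right]
  simp only [conj_trivial, one_mul, Real.norm_eq_abs, sq_abs]

end

/-- Lemma 6.1: for an origin-symmetric convex body `K` and an even log-concave measure
`μ` with density `e^{-V}`, one has `∫_K |∇V|² dμ ≤ ∫_K ΔV dμ`. -/
theorem integral_grad_sq_le_integral_lap (n : ℕ) (K : Set (Euc n))
    (hK : IsConvexBody K) (hKsym : K = -K)
    (V : Euc n → ℝ) (hV : ContDiff ℝ 2 V) (hVconv : ConvexOn ℝ Set.univ V)
    (hVeven : ∀ x, V (-x) = V x)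
    (μ : Measure (Euc n))
    (hμ : μ = volume.withDensity fun x => ENNReal.ofReal (Real.exp (-V x))) :
    ∫ x in K, ‖gradient V x‖ ^ 2 ∂μ ≤ ∫ x in K, lapl V x ∂μ := by
  obtain ⟨hKc, hKconv, -⟩ := hK
  have hw : Measurable fun x => ENNReal.ofReal (Real.exp (-V x)) := by
    have := hV.continuous
    fun_prop
  have hfin : ∀ᵐ x ∂volume.restrict K, ENNReal.ofReal (Real.exp (-V x)) < ∞ :=
    Filter.Eventually.of_forall fun x => ENNReal.ofReal_lt_top
  have hcg : ∀ i : Fin n,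
      Continuous fun x => fderiv ℝ V x (EuclideanSpace.single i 1) := fun i =>
    (hV.continuous_fderiv two_ne_zero).clm_apply continuous_const
  have hcl : ∀ i : Fin n, Continuous fun x => iteratedFDeriv ℝ 2 V x
      ![EuclideanSpace.single i 1, EuclideanSpace.single i 1] := fun i =>
    (ContinuousMultilinearMap.apply ℝ (fun _ : Fin 2 => Euc n) ℝ
      ![EuclideanSpace.single i 1, EuclideanSpace.single i 1]).continuous.comp
      (hV.continuous_iteratedFDeriv (m := 2) le_rfl)
  have hexp : Continuous fun x => Real.exp (-V x) := by
    have := hV.continuous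
    fun_prop
  have hint : ∀ k : Euc n → ℝ, Continuous k → IntegrableOn k K := fun k hk =>
    hk.continuousOn.integrableOn_compact hKc
  rw [hμ, setIntegral_withDensity_eq_setIntegral_toReal_smul hw hfin _ hKc.measurableSet,
    setIntegral_withDensity_eq_setIntegral_toReal_smul hw hfin _ hKc.measurableSet]
  simp only [ENNReal.toReal_ofReal (Real.exp_nonneg _), smul_eq_mul, norm_gradient_sq_eq_sum,
    lapl]
  rw [← sub_nonpos, ← integral_sub (hint _ (by fun_prop)) (hint _ (by fun_prop))]
  simp only [← mul_sub, ← Finset.sum_sub_distrib, Finset.mul_sum]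
  rw [integral_finsetSum _ fun i _ => hint _ (by fun_prop)]
  exact Finset.sum_nonpos fun i _ =>
    setIntegral_exp_neg_mul_nonpos hKc hKconv hKsym hV hVconv hVeven _

end
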